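/- arXiv:2501.18087 — 3 statements merged into one kernel-verified Lean document; each statement's English description precedes it below -/
import Mathlib

section
/- Let C be a category with pullbacks in which coproducts over an index type I exist, are disjoint, and are stable under pullback (i.e., the pullback of a coproduct cocone along any morphism is again a coproduct cocone). Then for any family Δ : I → C, the sieve on the coproduct ∐ᵢ Δᵢ generated by the presieve of coproduct injections {injⱼ : Δⱼ ⟶ ∐ᵢ Δᵢ | j ∈ I} belongs to the canonical Grothendieck topology on C. -/
open CategoryTheory Limits

/-- A representable presheaf is a sheaf for the family of injections of any colimit cofan. -/
theorem isSheafFor_yoneda_of_isColimit {C : Type*} [Category C] {I : Type*} {X : I → C}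
    {c : Cofan X} (hc : IsColimit c) (W : C) :
    (Presieve.ofArrows X c.inj).IsSheafFor (yoneda.obj W) := by
  rw [Presieve.isSheafFor_arrows_iff]
  exact fun x _ ↦ ⟨Cofan.IsColimit.desc hc x, fun i ↦ Cofan.IsColimit.fac hc x i,
    fun t ht ↦ Cofan.IsColimit.hom_ext hc _ _ fun i ↦
      (ht i).trans (Cofan.IsColimit.fac hc x i).symm⟩

/-- If `C` has pullbacks and coproducts over `I` exist, are disjoint (injections are monos and
the pullback of two distinct injections is initial), and are stable under pullback (the coproduct
cocone is a universal colimit), then the sieve generated by the coproduct injections belongs to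
the canonical topology. -/
theorem generate_ofArrows_sigmaι_mem_canonicalTopology {C : Type*} [Category C]
    [HasPullbacks C] {I : Type*} (Δ : I → C) [HasCoproduct Δ]
    (hmono : ∀ j : I, Mono (Sigma.ι Δ j))
    (hdisj : ∀ j k : I, j ≠ k → IsInitial (pullback (Sigma.ι Δ j) (Sigma.ι Δ k)))
    (huniv : IsUniversalColimit (colimit.cocone (Discrete.functor Δ))) :
    Sieve.generate (Presieve.ofArrows Δ (fun j => Sigma.ι Δ j)) ∈
      Sheaf.canonicalTopology C (∐ Δ) := by
  refine Sheaf.mem_finestTopology_of_forall_isSheafFor ?_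
  rintro _ ⟨W, rfl⟩ Y f
  have hP (j : I) := IsPullback.of_hasPullback f (Sigma.ι Δ j)
  obtain ⟨hd⟩ := huniv.nonempty_isColimit_of_isPullback_left (Sigma.ι Δ) (𝟙 _) f _ _ hP
    (IsPullback.id_horiz f) (Cofan.mk Y fun j ↦ pullback.fst f (Sigma.ι Δ j)) (Iso.refl Y)
    (fun _ ↦ Category.comp_id _) (fun _ ↦ by simp)
    (fun j ↦ (congrArg _ (Category.id_comp f)).trans (hP j).w)
  have hsieve := Sieve.ofArrows_eq_pullback_of_isPullback (Sigma.ι Δ) hP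
  rw [Sieve.ofArrows, Sieve.ofArrows] at hsieve
  rw [← hsieve, ← Presieve.isSheafFor_iff_generate]
  exact isSheafFor_yoneda_of_isColimit hd W
end

section
/- Let C be a category with pullbacks and a strict initial object. Let R be a presieve on an object Γ whose generated sieve belongs to the canonical Grothendieck topology on C, and let θ : Δ ⟶ Γ be an arrow of R whose domain Δ is an initial object of C. Then the sieve on Γ generated by the presieve R with θ removed (R \ {θ}) also belongs to the canonical Grothendieck topology on C. -/
open CategoryTheory Limits

/-- The empty sieve on a strict initial object is in the canonical topology. -/
theorem bot_mem_canonicalTopology_of_isInitial {C : Type*} [Category C]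
    [HasStrictInitialObjects C] {I : C} (hI : IsInitial I) :
    (⊥ : Sieve I) ∈ Sheaf.canonicalTopology C I := by
  refine Sheaf.mem_finestTopology_of_forall_isSheafFor ?_
  rintro _ ⟨X, rfl⟩ Y f
  have hY : IsInitial Y := IsInitial.ofStrict f hI
  exact fun x _ ↦ ⟨hY.to X, fun _ _ hg ↦ hg.elim, fun _ _ ↦ hY.hom_ext _ _⟩

/-- Pruning absurd covers: if `C` has pullbacks and a strict initial object, `R` is a presieve
on `Γ` whose generated sieve is in the canonical topology, and `θ : Δ ⟶ Γ` is an arrow of `R`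
whose domain is initial, then the sieve generated by `R` with `θ` removed is also in the
canonical topology. -/
theorem generate_sdiff_singleton_mem_canonicalTopology {C : Type*} [Category C]
    [HasPullbacks C] [HasInitial C] [HasStrictInitialObjects C]
    {Γ Δ : C} (R : Presieve Γ)
    (hR : Sieve.generate R ∈ Sheaf.canonicalTopology C Γ)
    (θ : Δ ⟶ Γ) (hθ : R θ) (hΔ : IsInitial Δ) :
    Sieve.generate (fun Y (f : Y ⟶ Γ) => R f ∧ ¬ Presieve.singleton θ f) ∈
      Sheaf.canonicalTopology C Γ := by
  refine (Sheaf.canonicalTopology C).transitive hR _ ?_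
  rintro Y _ ⟨Z, g, r, hr, rfl⟩
  by_cases h : Presieve.singleton θ r
  · cases h
    exact (Sheaf.canonicalTopology C).superset_covering bot_le
      (bot_mem_canonicalTopology_of_isInitial (IsInitial.ofStrict g hΔ))
  · rw [(Sieve.mem_iff_pullback_eq_top (g ≫ r)).mp]
    · exact (Sheaf.canonicalTopology C).top_mem Y
    · exact ⟨Z, g, r, ⟨hr, h⟩, rfl⟩
end

section
/- In the category of presheaves Cᵒᵖ ⥤ Type u on a small category C, for any index type I and family of presheaves Δ : I → (Cᵒᵖ ⥤ Type u), the sieve on the coproduct ∐ᵢ Δᵢ generated by the presieve of coproduct injections {injⱼ : Δⱼ ⟶ ∐ᵢ Δᵢ | j ∈ I} belongs to the canonical Grothendieck topology on the presheaf category. -/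
open CategoryTheory Limits

namespace CategoryTheory

/-- A sieve in a presheaf category that contains every morphism out of a representable presheaf
satisfies the sheaf condition for every representable functor. -/
lemma Sieve.isSheafFor_yoneda_of_forall_yoneda_mem {C : Type u} [Category.{v} C]
    {X : Cᵒᵖ ⥤ Type v} {S : Sieve X} (hS : ∀ ⦃U : C⦄ (p : yoneda.obj U ⟶ X), S p)
    (W : Cᵒᵖ ⥤ Type v) : Presieve.IsSheafFor (yoneda.obj W) S.arrows := by
  intro x hx
  have hx' := (Presieve.compatible_iff_sieveCompatible x).mp hx
  let φ : X ⟶ W :=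
    { app := fun U => ↾fun s => yonedaEquiv (x (yonedaEquiv.symm s) (hS (U := U.unop) _))
      naturality := by
        intro U V f
        ext s
        have key : x (yonedaEquiv.symm (X.map f s)) (hS _) =
            yoneda.map f.unop ≫ x (yonedaEquiv.symm s) (hS _) := by
          refine Eq.trans ?_ (hx' (yonedaEquiv.symm s) (yoneda.map f.unop) (hS _))
          congr 1
          exact yonedaEquiv_symm_map f s
        exact (congrArg yonedaEquiv key).trans (yonedaEquiv_naturality' _ f).symm }
  have hφ {U : C} (p : yoneda.obj U ⟶ X) : p ≫ φ = x p (hS p) := by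
    apply yonedaEquiv.injective
    obtain ⟨s, rfl⟩ := yonedaEquiv.symm.surjective p
    rw [yonedaEquiv_comp, Equiv.apply_symm_apply]
    rfl
  refine ⟨φ, fun Y f hf => hom_ext_yoneda fun U p => ?_, fun ψ hψ => hom_ext_yoneda fun U p => ?_⟩
  · exact (Category.assoc p f φ).symm.trans ((hφ (p ≫ f)).trans (hx' f p hf))
  · exact (hψ p (hS p)).trans (hφ p).symm

/-- A jointly surjective sieve in a presheaf category belongs to the canonical topology. -/
lemma Sieve.mem_canonicalTopology_presheaf_of_jointly_surjective {C : Type u} [Category.{v} C]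
    {X : Cᵒᵖ ⥤ Type v} (S : Sieve X)
    (hS : ∀ ⦃U : Cᵒᵖ⦄ (s : X.obj U), ∃ (Y : Cᵒᵖ ⥤ Type v) (f : Y ⟶ X) (t : Y.obj U),
      S f ∧ f.app U t = s) :
    S ∈ Sheaf.canonicalTopology (Cᵒᵖ ⥤ Type v) X := by
  apply Sheaf.mem_finestTopology_of_forall_isSheafFor
  rintro _ ⟨W, rfl⟩ Y g
  refine isSheafFor_yoneda_of_forall_yoneda_mem (fun U p => ?_) W
  obtain ⟨Z, f, t, hf, ht⟩ := hS (yonedaEquiv (p ≫ g))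
  have h : p ≫ g = yonedaEquiv.symm t ≫ f := by
    rw [yonedaEquiv_symm_naturality_right, ht, Equiv.symm_apply_apply]
  change S (p ≫ g)
  rw [h]
  exact S.downward_closed hf _

end CategoryTheory

/-- In a presheaf category, the sieve generated by the injections into a coproduct of
presheaves belongs to the canonical topology. -/
theorem generate_ofArrows_sigmaι_presheaf_mem_canonicalTopology
    {C : Type u} [SmallCategory C] {I : Type u} (Δ : I → (Cᵒᵖ ⥤ Type u)) :
    Sieve.generate (Presieve.ofArrows Δ (fun j => Sigma.ι Δ j)) ∈
      Sheaf.canonicalTopology (Cᵒᵖ ⥤ Type u) (∐ Δ) := by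
  apply Sieve.mem_canonicalTopology_presheaf_of_jointly_surjective
  intro U s
  obtain ⟨⟨j⟩, t, ht⟩ := Types.jointly_surjective_of_isColimit
    (isColimitOfPreserves ((evaluation Cᵒᵖ (Type u)).obj U) (coproductIsCoproduct Δ)) s
  exact ⟨Δ j, Sigma.ι Δ j, t, Sieve.le_generate _ _ _ ⟨j⟩, ht⟩
end
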